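/- The function A ↦ −sqrt(‖y‖² − ‖Aᵀ y‖²), extended by +∞ outside D_y = {A : ‖y‖² − ‖Aᵀy‖² ≥ 0}, is convex on R^{d×K}, being the pointwise supremum over ε > 0 of the convex functions −F_ε. -/

import Mathlib

open Matrix

/-- Euclidean norm of a vector. -/
noncomputable def evn {d : ℕ} (v : Fin d → ℝ) : ℝ := Real.sqrt (∑ i, (v i) ^ 2)

theorem evn_sq {d : ℕ} (v : Fin d → ℝ) : evn v ^ 2 = ∑ i, v i ^ 2 :=
  Real.sq_sqrt (Finset.sum_nonneg fun i _ => sq_nonneg (v i))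

theorem convexOn_evn_sq {d : ℕ} : ConvexOn ℝ Set.univ fun v : Fin d → ℝ => evn v ^ 2 := by
  refine ⟨convex_univ, fun u _ v _ a b ha hb hab => ?_⟩
  simp only [evn_sq, smul_eq_mul, Finset.mul_sum, ← Finset.sum_add_distrib]
  exact Finset.sum_le_sum fun i _ =>
    (even_two.convexOn_pow (𝕜 := ℝ)).2 (Set.mem_univ (u i)) (Set.mem_univ (v i)) ha hb hab

theorem concaveOn_sub_evn_transpose_mulVec_sq {d K : ℕ} (y : Fin d → ℝ) (c : ℝ) :
    ConcaveOn ℝ Set.univ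
      fun A : Matrix (Fin d) (Fin K) ℝ => c - evn (Aᵀ.mulVec y) ^ 2 := by
  refine ⟨convex_univ, fun A _ B _ a b ha hb hab => ?_⟩
  have h := convexOn_evn_sq.2 (Set.mem_univ (Aᵀ.mulVec y)) (Set.mem_univ (Bᵀ.mulVec y)) ha hb hab
  simp only [transpose_add, transpose_smul, add_mulVec, smul_mulVec, smul_eq_mul] at h ⊢
  linear_combination h + c * hab

theorem ConcaveOn.sqrt {E : Type*} [AddCommGroup E] [Module ℝ E] {s : Set E} {f : E → ℝ}
    (hf : ConcaveOn ℝ s f) (h0 : ∀ x ∈ s, 0 ≤ f x) : ConcaveOn ℝ s fun x => √(f x) :=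
  ⟨hf.1, fun x hx y hy _ _ ha hb hab =>
    (Real.strictConcaveOn_sqrt.concaveOn.2 (h0 x hx) (h0 y hy) ha hb hab).trans
      (Real.sqrt_le_sqrt (hf.2 hx hy ha hb hab))⟩

/-- Convexity of `A ↦ -√(‖y‖² - ‖Aᵀy‖²)` on its domain `D_y` (extension by `+∞` outside the
convex set `D_y` then yields a convex function on all of `ℝ^{d×K}`). -/
theorem stmt5 {d K : ℕ} (y : Fin d → ℝ) :
    Convex ℝ {A : Matrix (Fin d) (Fin K) ℝ | 0 ≤ evn y ^ 2 - evn (Aᵀ.mulVec y) ^ 2} ∧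
    ConvexOn ℝ {A : Matrix (Fin d) (Fin K) ℝ | 0 ≤ evn y ^ 2 - evn (Aᵀ.mulVec y) ^ 2}
      (fun A => -Real.sqrt (evn y ^ 2 - evn (Aᵀ.mulVec y) ^ 2)) := by
  have hg := concaveOn_sub_evn_transpose_mulVec_sq (K := K) y (evn y ^ 2)
  have hD : Convex ℝ {A : Matrix (Fin d) (Fin K) ℝ | 0 ≤ evn y ^ 2 - evn (Aᵀ.mulVec y) ^ 2} := by
    simpa using hg.convex_ge 0
  exact ⟨hD, ((hg.subset (Set.subset_univ _) hD).sqrt fun _ hA => hA).neg⟩
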